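/- arXiv:2508.00541 — 10 statements merged into one kernel-verified Lean document; each statement's English description precedes it below -/
import Mathlib

section
/- Let x, q, y be real numbers with q ≤ x. Then the profit function admits the pointwise-minimum representation Π(x, q, y) = min{ p·d_y − c_m·x − c·q , (p − (c + δ))·d_y − c_m·x + δ·q , (p − (c + δ) − c_m)·x + δ·q }. -/
/-- Realized demand: `d_y = (1 - p) * y`. -/
noncomputable def dem (p y : ℝ) : ℝ := (1 - p) * y

/-- Second-stage (quick-response) production quantity. -/
noncomputable def qdel (p x q y : ℝ) : ℝ := min (max (dem p y - q) 0) (x - q)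

/-- Profit function. -/
noncomputable def profit (p c cm δ x q y : ℝ) : ℝ :=
  p * min (dem p y) (q + qdel p x q y) - cm * x - c * q - (c + δ) * qdel p x q y

theorem stmt2
    (p c cm δ : ℝ) (hp0 : 0 < p) (hp1 : p < 1)
    (hc : 0 < c) (hcm : 0 < cm) (hδ : 0 ≤ δ) (hprof : c + δ + cm < p)
    (x q y : ℝ) (hqx : q ≤ x) :
    profit p c cm δ x q y =
      min (p * dem p y - cm * x - c * q)
        (min ((p - (c + δ)) * dem p y - cm * x + δ * q)
          ((p - (c + δ) - cm) * x + δ * q)) := by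
  unfold profit qdel
  generalize dem p y = d
  have hm : 0 < p - (c + δ) := by linarith
  have hs : 0 < c + δ := by linarith
  rcases le_total d q with h | h
  · have h1 := mul_le_mul_of_nonneg_left h hs.le
    have h2 := mul_le_mul_of_nonneg_left (h.trans hqx) hm.le
    rw [max_eq_right (by linarith), min_eq_left (by linarith : (0:ℝ) ≤ x - q),
      min_eq_left (by linarith : d ≤ q + 0), min_eq_left]
    · ring
    · refine le_min ?_ ?_ <;> nlinarith
  · have h1 := mul_le_mul_of_nonneg_left h hs.le
    rw [max_eq_left (by linarith)]
    rcases le_total d x with h' | h'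
    · have h2 := mul_le_mul_of_nonneg_left h' hm.le
      rw [min_eq_left (by linarith : d - q ≤ x - q),
        min_eq_left (by linarith : d ≤ q + (d - q)),
        min_eq_left (by nlinarith : (p - (c + δ)) * d - cm * x + δ * q ≤ _),
        min_eq_right (by nlinarith)]
      ring
    · have h2 := mul_le_mul_of_nonneg_left h' hm.le
      rw [min_eq_right (by linarith : x - q ≤ d - q),
        min_eq_right (by linarith : q + (x - q) ≤ d),
        min_eq_right (by nlinarith : (p - (c + δ) - cm) * x + δ * q ≤ _),
        min_eq_right (by nlinarith)]
      ring
end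

section
/- The profit function (x, q, y) ↦ Π(x, q, y) is concave on the convex set {(x, q, y) ∈ ℝ³ : x ≥ q}; that is, for any two points (x₁, q₁, y₁), (x₂, q₂, y₂) with x₁ ≥ q₁ and x₂ ≥ q₂ and any t ∈ [0, 1], Π(t·x₁ + (1−t)·x₂, t·q₁ + (1−t)·q₂, t·y₁ + (1−t)·y₂) ≥ t·Π(x₁, q₁, y₁) + (1−t)·Π(x₂, q₂, y₂). -/
theorem profit_eq (p c cm δ x q y : ℝ) (h : q ≤ x) :
    profit p c cm δ x q y = (p - (c + δ)) * min (dem p y) x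
      + (c + δ) * min (dem p y) q - cm * x - c * q := by
  unfold profit qdel
  generalize dem p y = d
  rcases le_total d q with h1 | h1
  · rw [max_eq_right (by linarith), min_eq_left (by linarith : (0:ℝ) ≤ x - q),
      min_eq_left (by linarith), min_eq_left (by linarith : d ≤ x), min_eq_left h1]
    ring
  · rw [max_eq_left (by linarith), min_eq_right h1]
    rcases le_total d x with h2 | h2
    · rw [min_eq_left (by linarith : d - q ≤ x - q), min_eq_left (by linarith),
        min_eq_left h2]
      ring
    · rw [min_eq_right (by linarith : x - q ≤ d - q), min_eq_right (by linarith),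
        min_eq_right h2]
      ring

theorem min_conc (a b a' b' t : ℝ) (h0 : 0 ≤ t) (h1 : t ≤ 1) :
    t * min a b + (1 - t) * min a' b' ≤ min (t * a + (1 - t) * a') (t * b + (1 - t) * b') := by
  have h2 : 0 ≤ 1 - t := by linarith
  apply le_min
  · exact add_le_add (mul_le_mul_of_nonneg_left (min_le_left _ _) h0)
      (mul_le_mul_of_nonneg_left (min_le_left _ _) h2)
  · exact add_le_add (mul_le_mul_of_nonneg_left (min_le_right _ _) h0)
      (mul_le_mul_of_nonneg_left (min_le_right _ _) h2)

/-- The profit function is concave on the convex set `{(x, q, y) : x ≥ q}`. -/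
theorem stmt3
    (p c cm δ : ℝ) (hp0 : 0 < p) (hp1 : p < 1)
    (hc : 0 < c) (hcm : 0 < cm) (hδ : 0 ≤ δ) (hprof : c + δ + cm < p) :
    ∀ x₁ q₁ y₁ x₂ q₂ y₂ t : ℝ, x₁ ≥ q₁ → x₂ ≥ q₂ → 0 ≤ t → t ≤ 1 →
      profit p c cm δ (t * x₁ + (1 - t) * x₂) (t * q₁ + (1 - t) * q₂)
          (t * y₁ + (1 - t) * y₂) ≥
        t * profit p c cm δ x₁ q₁ y₁ + (1 - t) * profit p c cm δ x₂ q₂ y₂ := by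
  intro x₁ q₁ y₁ x₂ q₂ y₂ t hx₁ hx₂ h0 h1
  have h2 : 0 ≤ 1 - t := by linarith
  have hq : t * q₁ + (1 - t) * q₂ ≤ t * x₁ + (1 - t) * x₂ :=
    add_le_add (mul_le_mul_of_nonneg_left hx₁ h0) (mul_le_mul_of_nonneg_left hx₂ h2)
  rw [profit_eq _ _ _ _ _ _ _ hq, profit_eq _ _ _ _ _ _ _ hx₁, profit_eq _ _ _ _ _ _ _ hx₂]
  have hd : dem p (t * y₁ + (1 - t) * y₂) = t * dem p y₁ + (1 - t) * dem p y₂ := by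
    unfold dem
    ring
  rw [hd]
  have e1 := mul_le_mul_of_nonneg_left (min_conc (dem p y₁) x₁ (dem p y₂) x₂ t h0 h1)
    (by linarith : 0 ≤ p - (c + δ))
  have e2 := mul_le_mul_of_nonneg_left (min_conc (dem p y₁) q₁ (dem p y₂) q₂ t h0 h1)
    (by linarith : 0 ≤ c + δ)
  linarith
end

section
/- Let x, q, y be real numbers with q ≤ x. Then the total waste identity holds: max(q − d_y, 0) + max(x − q − q_δ(x, q, y), 0) = max(x − d_y, 0); that is, the unsold finished goods plus the unused fabric equal (x − d_y)⁺. -/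
/-- Unsold finished goods plus unused fabric equal the total waste `(x - d_y)⁺`. -/
theorem stmt5
    (p c cm δ : ℝ) (hp0 : 0 < p) (hp1 : p < 1)
    (hc : 0 < c) (hcm : 0 < cm) (hδ : 0 ≤ δ) (hprof : c + δ + cm < p)
    (x q y : ℝ) (hqx : q ≤ x) :
    max (q - dem p y) 0 + max (x - q - qdel p x q y) 0 = max (x - dem p y) 0 := by
  unfold qdel
  generalize dem p y = d
  rcases le_total d q with h | h
  · rw [max_eq_left (by linarith : (0:ℝ) ≤ q - d), max_eq_right (by linarith : d - q ≤ 0),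
      min_eq_left (by linarith : (0:ℝ) ≤ x - q), max_eq_left (by linarith : (0:ℝ) ≤ x - q - 0),
      max_eq_left (by linarith : (0:ℝ) ≤ x - d)]
    ring
  · rw [max_eq_right (by linarith : q - d ≤ 0), max_eq_left (by linarith : (0:ℝ) ≤ d - q)]
    rcases le_total d x with h' | h'
    · rw [min_eq_left (by linarith : d - q ≤ x - q)]
      ring_nf
    · rw [min_eq_right (by linarith : x - q ≤ d - q), max_eq_right (by linarith : x - d ≤ 0)]
      simp
end

section
/- Let 0 < y̲ ≤ ȳ, let τ ≥ 0, and let x, q ∈ [y̲, ȳ] with q ≤ x. Let Q be a Borel probability measure on ℝ with Q([y̲, ȳ]) = 1. Then ∫ min{d_y, q + q_δ(x, q, y)} dQ(y) > 0, and the waste-to-consumption ratio constraint ( ∫ max(q − d_y, 0) dQ(y) + ∫ max(x − q − q_δ(x, q, y), 0) dQ(y) ) / ( ∫ min{d_y, q + q_δ(x, q, y)} dQ(y) ) ≤ τ holds if and only if ∫ max{x − (1 + τ)·d_y, −τ·x} dQ(y) ≤ 0. -/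
open MeasureTheory

theorem stmt7
    (p c cm δ : ℝ) (hp0 : 0 < p) (hp1 : p < 1)
    (hc : 0 < c) (hcm : 0 < cm) (hδ : 0 ≤ δ) (hprof : c + δ + cm < p)
    (ylo yhi : ℝ) (hylo : 0 < ylo) (hlohi : ylo ≤ yhi)
    (τ : ℝ) (hτ : 0 ≤ τ)
    (x q : ℝ) (hx : x ∈ Set.Icc ylo yhi) (hq : q ∈ Set.Icc ylo yhi) (hqx : q ≤ x)
    (Q : Measure ℝ) [IsProbabilityMeasure Q] (hQ : Q (Set.Icc ylo yhi) = 1) :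
    0 < (∫ y, min (dem p y) (q + qdel p x q y) ∂Q) ∧
    (((∫ y, max (q - dem p y) 0 ∂Q) + (∫ y, max (x - q - qdel p x q y) 0 ∂Q)) /
        (∫ y, min (dem p y) (q + qdel p x q y) ∂Q) ≤ τ ↔
      (∫ y, max (x - (1 + τ) * dem p y) (-(τ * x)) ∂Q) ≤ 0) := by
  have hae : ∀ᵐ y ∂Q, y ∈ Set.Icc ylo yhi := by
    rw [← prob_compl_eq_zero_iff measurableSet_Icc] at hQ
    exact hQ
  have hint : ∀ f : ℝ → ℝ, Continuous f → Integrable f Q := by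
    intro f hf
    have h := hf.integrableOn_Icc (μ := Q) (a := ylo) (b := yhi)
    rwa [IntegrableOn, Measure.restrict_eq_self_of_ae_mem hae] at h
  have hd : Continuous (dem p) := by unfold dem; fun_prop
  have hqd : Continuous (qdel p x q) := by unfold qdel; fun_prop
  have hS : ∀ y, min (dem p y) (q + qdel p x q y) = min (dem p y) x := by
    intro y
    unfold qdel
    grind
  have hW : ∀ y, max (q - dem p y) 0 + max (x - q - qdel p x q y) 0
      = x - min (dem p y) x := by
    intro y
    unfold qdel
    grind
  have hM : ∀ y, max (x - (1 + τ) * dem p y) (-(τ * x))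
      = x - (1 + τ) * min (dem p y) x := by
    intro y
    rcases le_total (dem p y) x with h | h
    · rw [min_eq_left h, max_eq_left]
      nlinarith
    · rw [min_eq_right h, max_eq_right]
      · ring
      · nlinarith
  have hSi : Integrable (fun y => min (dem p y) x) Q := hint _ (by fun_prop)
  have hpos : 0 < ∫ y, min (dem p y) x ∂Q := by
    have hm : 0 < min ((1 - p) * ylo) x :=
      lt_min (mul_pos (by linarith) hylo) (lt_of_lt_of_le hylo hx.1)
    have h : ∫ _y, min ((1 - p) * ylo) x ∂Q ≤ ∫ y, min (dem p y) x ∂Q := by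
      apply integral_mono_ae (integrable_const _) hSi
      filter_upwards [hae] with y hy
      exact min_le_min_right _ (mul_le_mul_of_nonneg_left hy.1 (by linarith))
    simp only [integral_const, probReal_univ, one_smul] at h
    linarith
  rw [← integral_add (hint _ (by fun_prop)) (hint _ (by fun_prop))]
  simp only [hS, hW, hM]
  refine ⟨hpos, ?_⟩
  rw [integral_sub (integrable_const _) hSi,
    integral_sub (integrable_const _) (hSi.const_mul _), integral_const_mul, div_le_iff₀ hpos]
  simp only [integral_const, probReal_univ, one_smul]
  constructor <;> intro h <;> linarith
end

section
/- The three-point measure ℙ* := w_y̲·δ_{y̲} + w_μ·δ_{μ} + w_ȳ·δ_{ȳ} (where δ_a denotes the Dirac measure at a) is a Borel probability measure on ℝ satisfying ℙ*([y̲, ȳ]) = 1, ∫ y dℙ*(y) = μ, and ∫ |y − μ| dℙ*(y) = σ; in particular ℙ* belongs to the mean-MAD ambiguity set 𝒫. -/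
open MeasureTheory

/-- The mean-MAD ambiguity set: Borel probability measures on `ℝ` supported on
`[ylo, yhi]` with mean `μ` and mean absolute deviation `σ`. -/
def madSet (ylo yhi μ σ : ℝ) : Set (Measure ℝ) :=
  {Q | IsProbabilityMeasure Q ∧ Q (Set.Icc ylo yhi) = 1 ∧
    (∫ y, y ∂Q) = μ ∧ (∫ y, |y - μ| ∂Q) = σ}

theorem stmt9
    (ylo μ yhi σ : ℝ) (h1 : ylo < μ) (h2 : μ < yhi) (hσ : 0 < σ)
    (hfeas : σ / (2 * (μ - ylo)) + σ / (2 * (yhi - μ)) ≤ 1)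
    (wlo wmu whi : ℝ)
    (hwlo : wlo = σ / (2 * (μ - ylo)))
    (hwhi : whi = σ / (2 * (yhi - μ)))
    (hwmu : wmu = 1 - wlo - whi)
    (Pstar : Measure ℝ)
    (hPstar : Pstar = ENNReal.ofReal wlo • Measure.dirac ylo +
      ENNReal.ofReal wmu • Measure.dirac μ + ENNReal.ofReal whi • Measure.dirac yhi) :
    IsProbabilityMeasure Pstar ∧ Pstar (Set.Icc ylo yhi) = 1 ∧
    (∫ y, y ∂Pstar) = μ ∧ (∫ y, |y - μ| ∂Pstar) = σ ∧
    Pstar ∈ madSet ylo yhi μ σ := by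
  have hlo : 0 < wlo := by
    rw [hwlo]; exact div_pos hσ (by linarith)
  have hhi : 0 < whi := by
    rw [hwhi]; exact div_pos hσ (by linarith)
  have hmu : 0 ≤ wmu := by
    rw [hwmu, hwlo, hwhi]; linarith
  have e1 : wlo * (μ - ylo) = σ / 2 := by
    have : μ - ylo ≠ 0 := by linarith
    rw [hwlo]; field_simp
  have e2 : whi * (yhi - μ) = σ / 2 := by
    have : yhi - μ ≠ 0 := by linarith
    rw [hwhi]; field_simp
  have hsum : ENNReal.ofReal wlo + ENNReal.ofReal wmu + ENNReal.ofReal whi = 1 := by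
    rw [← ENNReal.ofReal_add hlo.le hmu, ← ENNReal.ofReal_add (by linarith) hhi.le]
    rw [show wlo + wmu + whi = 1 by linarith, ENNReal.ofReal_one]
  have hint : ∀ f : ℝ → ℝ, ∫ y, f y ∂Pstar = wlo * f ylo + wmu * f μ + whi * f yhi := by
    intro f
    have hd : ∀ a w : ℝ, Integrable f (ENNReal.ofReal w • Measure.dirac a) := fun a w =>
      (integrable_dirac (by simp)).smul_measure ENNReal.ofReal_ne_top
    rw [hPstar, integral_add_measure ((hd _ _).add_measure (hd _ _)) (hd _ _),
      integral_add_measure (hd _ _) (hd _ _)]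
    simp [integral_smul_measure, ENNReal.toReal_ofReal, hlo.le, hmu, hhi.le]
  have p1 : IsProbabilityMeasure Pstar := ⟨by rw [hPstar]; simpa using hsum⟩
  have p2 : Pstar (Set.Icc ylo yhi) = 1 := by
    have m1 : ylo ∈ Set.Icc ylo yhi := ⟨le_rfl, by linarith⟩
    have m2 : μ ∈ Set.Icc ylo yhi := ⟨h1.le, h2.le⟩
    have m3 : yhi ∈ Set.Icc ylo yhi := ⟨by linarith, le_rfl⟩
    rw [hPstar]
    simp only [Measure.add_apply, Measure.smul_apply, Measure.dirac_apply_of_mem m1,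
      Measure.dirac_apply_of_mem m2, Measure.dirac_apply_of_mem m3, smul_eq_mul, mul_one]
    exact hsum
  have p3 : (∫ y, y ∂Pstar) = μ := by
    rw [hint (fun y => y), hwmu]; linarith
  have p4 : (∫ y, |y - μ| ∂Pstar) = σ := by
    rw [hint (fun y => |y - μ|)]
    simp only [sub_self, abs_zero]
    rw [abs_of_neg (by linarith), abs_of_pos (by linarith)]
    linarith
  exact ⟨p1, p2, p3, p4, p1, p2, p3, p4⟩
end

section
/- For every pair (x, q) with d_y̲ ≤ q ≤ x ≤ d_ȳ, there exists a pair (x′, q′) in the six-point set S := {(d_y̲, d_y̲), (d_μ, d_y̲), (d_μ, d_μ), (d_ȳ, d_y̲), (d_ȳ, d_μ), (d_ȳ, d_ȳ)} such that F(x′, q′) ≥ F(x, q); consequently, the maximum of F over the polytope {(x, q) : d_y̲ ≤ q ≤ x ≤ d_ȳ} is attained at one of the six points of S. -/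
theorem profit_sep (p c cm δ x q y : ℝ) (h : q ≤ x) :
    profit p c cm δ x q y = ((p - c - δ) * min (dem p y) x - cm * x)
      + (-c * q + (c + δ) * min (dem p y) q) := by
  unfold profit qdel
  generalize dem p y = d
  rcases le_total d q with h1 | h1
  · rw [max_eq_right (by linarith), min_eq_left (by linarith : (0:ℝ) ≤ x - q),
      min_eq_left (by linarith : d ≤ q + 0), min_eq_left (h1.trans h), min_eq_left h1]
    ring
  · rw [max_eq_left (by linarith), min_eq_right h1]
    rcases le_total d x with h2 | h2
    · rw [min_eq_left (by linarith : d - q ≤ x - q), min_eq_left (by linarith : d ≤ q + (d - q)),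
        min_eq_left h2]
      ring
    · rw [min_eq_right (by linarith : x - q ≤ d - q),
        min_eq_right (by linarith : q + (x - q) ≤ d), min_eq_right h2]
      ring

/-- An affine separable function on a triangle is at most one of the vertex values. -/
theorem tri_bound (A B : ℝ → ℝ) (a b x q : ℝ) (hab : a < b) (h1 : a ≤ q) (h2 : q ≤ x) (h3 : x ≤ b)
    (hA : (b - a) * A x = (b - x) * A a + (x - a) * A b)
    (hB : (b - a) * B q = (b - q) * B a + (q - a) * B b) :
    A x + B q ≤ A a + B a ∨ A x + B q ≤ A b + B a ∨ A x + B q ≤ A b + B b := by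
  by_contra! hcon
  obtain ⟨e1, e2, e3⟩ := hcon
  have key : (b - x) * (A x + B q - (A a + B a)) + (x - q) * (A x + B q - (A b + B a))
      + (q - a) * (A x + B q - (A b + B b)) = 0 := by linear_combination hA + hB
  have k1 := mul_nonneg (sub_nonneg.2 h3) (sub_pos.2 e1).le
  have k2 := mul_nonneg (sub_nonneg.2 h2) (sub_pos.2 e2).le
  have k3 := mul_nonneg (sub_nonneg.2 h1) (sub_pos.2 e3).le
  have z1 : (b - x) * (A x + B q - (A a + B a)) = 0 := by linarith
  have z2 : (x - q) * (A x + B q - (A b + B a)) = 0 := by linarith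
  have z3 : (q - a) * (A x + B q - (A b + B b)) = 0 := by linarith
  have y1 := (mul_eq_zero.1 z1).resolve_right (sub_pos.2 e1).ne'
  have y2 := (mul_eq_zero.1 z2).resolve_right (sub_pos.2 e2).ne'
  have y3 := (mul_eq_zero.1 z3).resolve_right (sub_pos.2 e3).ne'
  linarith

/-- An affine function on an interval is at most one of the endpoint values. -/
theorem seg_bound (A : ℝ → ℝ) (a b x : ℝ) (hab : a < b) (h1 : a ≤ x) (h3 : x ≤ b)
    (hA : (b - a) * A x = (b - x) * A a + (x - a) * A b) :
    A x ≤ A a ∨ A x ≤ A b := by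
  have := tri_bound A (fun _ => 0) a b x x hab h1 le_rfl h3 hA (by simp)
  simp only [add_zero] at this
  tauto

theorem stmt10
    (p c cm δ : ℝ) (hp0 : 0 < p) (hp1 : p < 1)
    (hc : 0 < c) (hcm : 0 < cm) (hδ : 0 ≤ δ) (hprof : c + δ + cm < p)
    (ylo μ yhi σ : ℝ) (h1 : ylo < μ) (h2 : μ < yhi) (hσ : 0 < σ)
    (hfeas : σ / (2 * (μ - ylo)) + σ / (2 * (yhi - μ)) ≤ 1)
    (wlo wmu whi : ℝ)
    (hwlo : wlo = σ / (2 * (μ - ylo)))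
    (hwhi : whi = σ / (2 * (yhi - μ)))
    (hwmu : wmu = 1 - wlo - whi)
    (dlo dmu dhi : ℝ)
    (hdlo : dlo = (1 - p) * ylo) (hdmu : dmu = (1 - p) * μ) (hdhi : dhi = (1 - p) * yhi)
    (F : ℝ → ℝ → ℝ)
    (hF : F = fun x q => wlo * profit p c cm δ x q ylo + wmu * profit p c cm δ x q μ +
      whi * profit p c cm δ x q yhi)
    (S : Set (ℝ × ℝ))
    (hS : S = {(dlo, dlo), (dmu, dlo), (dmu, dmu), (dhi, dlo), (dhi, dmu), (dhi, dhi)}) :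
    (∀ x q : ℝ, dlo ≤ q → q ≤ x → x ≤ dhi → ∃ pq ∈ S, F pq.1 pq.2 ≥ F x q) ∧
    (∃ pq ∈ S, ∀ x q : ℝ, dlo ≤ q → q ≤ x → x ≤ dhi → F pq.1 pq.2 ≥ F x q) := by
  have hdl : dem p ylo = dlo := hdlo.symm
  have hdm : dem p μ = dmu := hdmu.symm
  have hdh : dem p yhi = dhi := hdhi.symm
  have l1 : dlo < dmu := by
    rw [hdlo, hdmu]; exact mul_lt_mul_of_pos_left h1 (by linarith)
  have l2 : dmu < dhi := by
    rw [hdmu, hdhi]; exact mul_lt_mul_of_pos_left h2 (by linarith)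
  -- both parts of the separable form are piecewise affine
  have aff : ∀ (K L : ℝ) (G : ℝ → ℝ),
      (∀ x, G x = K * (wlo * min dlo x + wmu * min dmu x + whi * min dhi x) + L * x) →
      (∀ x, dlo ≤ x → x ≤ dmu → (dmu - dlo) * G x = (dmu - x) * G dlo + (x - dlo) * G dmu) ∧
      (∀ x, dmu ≤ x → x ≤ dhi → (dhi - dmu) * G x = (dhi - x) * G dmu + (x - dmu) * G dhi) := by
    intro K L G hG
    have lo : ∀ x, dlo ≤ x → x ≤ dmu →
        G x = K * (wlo * dlo + wmu * x + whi * x) + L * x := by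
      intro x a b
      rw [hG, min_eq_left a, min_eq_right b, min_eq_right (b.trans l2.le)]
    have hi : ∀ x, dmu ≤ x → x ≤ dhi →
        G x = K * (wlo * dlo + wmu * dmu + whi * x) + L * x := by
      intro x a b
      rw [hG, min_eq_left (l1.le.trans a), min_eq_left a, min_eq_right b]
    constructor
    · intro x a b
      rw [lo x a b, lo dlo le_rfl l1.le, lo dmu l1.le le_rfl]; ring
    · intro x a b
      rw [hi x a b, hi dmu le_rfl l2.le, hi dhi l2.le le_rfl]; ring
  obtain ⟨A, hA⟩ : ∃ A : ℝ → ℝ, ∀ x, A x = (p - c - δ) *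
    (wlo * min dlo x + wmu * min dmu x + whi * min dhi x) + (-cm) * x := ⟨_, fun _ => rfl⟩
  obtain ⟨B, hB⟩ : ∃ B : ℝ → ℝ, ∀ x, B x = (c + δ) *
    (wlo * min dlo x + wmu * min dmu x + whi * min dhi x) + (-c) * x := ⟨_, fun _ => rfl⟩
  have hsep : ∀ x q, q ≤ x → F x q = A x + B q := by
    intro x q h
    rw [hF, hA, hB]
    simp only [profit_sep _ _ _ _ _ _ _ h, hdl, hdm, hdh]
    rw [hwmu]; ring
  obtain ⟨A1, A2⟩ := aff _ _ A hA
  obtain ⟨B1, B2⟩ := aff _ _ B hB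
  have main : ∀ x q : ℝ, dlo ≤ q → q ≤ x → x ≤ dhi → ∃ pq ∈ S, F pq.1 pq.2 ≥ F x q := by
    intro x q a b d
    have fin : ∀ u v, (u, v) ∈ S → v ≤ u → A x + B q ≤ A u + B v →
        ∃ pq ∈ S, F pq.1 pq.2 ≥ F x q := by
      intro u v m e f
      refine ⟨(u, v), m, ?_⟩
      simp only [hsep u v e, hsep x q b]
      exact f
    rcases le_total x dmu with hx | hx
    · rcases tri_bound A B dlo dmu x q l1 a b hx (A1 x (a.trans b) hx) (B1 q a (b.trans hx))
        with h | h | h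
      · exact fin _ _ (by simp [hS]) le_rfl h
      · exact fin _ _ (by simp [hS]) l1.le h
      · exact fin _ _ (by simp [hS]) le_rfl h
    · rcases le_total q dmu with hq | hq
      · rcases seg_bound A dmu dhi x l2 hx d (A2 x hx d) with h | h <;>
        rcases seg_bound B dlo dmu q l1 a hq (B1 q a hq) with h' | h'
        · exact fin _ _ (by simp [hS]) l1.le (add_le_add h h')
        · exact fin _ _ (by simp [hS]) le_rfl (add_le_add h h')
        · exact fin _ _ (by simp [hS]) (l1.trans l2).le (add_le_add h h')
        · exact fin _ _ (by simp [hS]) l2.le (add_le_add h h')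
      · rcases tri_bound A B dmu dhi x q l2 hq b d (A2 x hx d) (B2 q hq (b.trans d))
          with h | h | h
        · exact fin _ _ (by simp [hS]) le_rfl h
        · exact fin _ _ (by simp [hS]) l2.le h
        · exact fin _ _ (by simp [hS]) le_rfl h
  refine ⟨main, ?_⟩
  have hfin : S.Finite := by rw [hS]; exact Set.toFinite _
  have hne : S.Nonempty := ⟨(dlo, dlo), by simp [hS]⟩
  obtain ⟨m, hm, hmax⟩ := Set.exists_max_image S (fun pq => F pq.1 pq.2) hfin hne
  refine ⟨m, hm, fun x q a b d => ?_⟩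
  obtain ⟨r, hr, hr2⟩ := main x q a b d
  exact hr2.le.trans (hmax r hr)
end

section
/- Let τ ≥ 0 and let x be a real number with (1 − p)·y̲ ≤ x ≤ (1 − p)·ȳ. Then the worst-case expected waste-to-consumption functional over the mean-MAD ambiguity set satisfies sup { ∫ max{x − (1 + τ)·(1 − p)·y, −τ·x} dQ(y) : Q ∈ 𝒫 } = w_y̲·(x − (1 + τ)·(1 − p)·y̲) + w_μ·max{x − (1 + τ)·(1 − p)·μ, −τ·x} − w_ȳ·τ·x. -/
open MeasureTheory

lemma aux_pointwise (a b c ylo μ yhi F L : ℝ) (h1 : ylo < μ) (h2 : μ < yhi)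
    (hF1 : a - b * μ ≤ F) (hF2 : c ≤ F) (hL1 : a - b * ylo ≤ L) (hL2 : c ≤ L)
    (hH : a - b * yhi ≤ c) (y : ℝ) (hy1 : ylo ≤ y) (hy2 : y ≤ yhi) :
    max (a - b * y) c ≤ F + (c - F) / (2 * (yhi - μ)) * (|y - μ| + (y - μ))
      + (L - F) / (2 * (μ - ylo)) * (|y - μ| - (y - μ)) := by
  have e1 : 0 < yhi - μ := by linarith
  have e2 : 0 < μ - ylo := by linarith
  rcases le_total μ y with h | h
  · rw [abs_of_nonneg (by linarith)]
    have key : F + (c - F) / (2 * (yhi - μ)) * ((y - μ) + (y - μ))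
      + (L - F) / (2 * (μ - ylo)) * ((y - μ) - (y - μ))
      = ((yhi - y) * F + (y - μ) * c) / (yhi - μ) := by
      field_simp
      ring
    rw [key, le_div_iff₀ e1]
    rcases max_choice (a - b * y) c with hm | hm <;> rw [hm]
    · nlinarith [mul_le_mul_of_nonneg_left hF1 (sub_nonneg.2 hy2),
        mul_le_mul_of_nonneg_left hH (sub_nonneg.2 h)]
    · nlinarith [mul_le_mul_of_nonneg_left hF2 (sub_nonneg.2 hy2)]
  · rw [abs_of_nonpos (by linarith)]
    have key : F + (c - F) / (2 * (yhi - μ)) * (-(y - μ) + (y - μ))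
      + (L - F) / (2 * (μ - ylo)) * (-(y - μ) - (y - μ))
      = ((y - ylo) * F + (μ - y) * L) / (μ - ylo) := by
      field_simp
      ring
    rw [key, le_div_iff₀ e2]
    rcases max_choice (a - b * y) c with hm | hm <;> rw [hm]
    · nlinarith [mul_le_mul_of_nonneg_left hF1 (sub_nonneg.2 hy1),
        mul_le_mul_of_nonneg_left hL1 (sub_nonneg.2 h)]
    · nlinarith [mul_le_mul_of_nonneg_left hF2 (sub_nonneg.2 hy1),
        mul_le_mul_of_nonneg_left hL2 (sub_nonneg.2 h)]

lemma aux_integral (u v w r s t : ℝ) (hu : 0 ≤ u) (hv : 0 ≤ v) (hw : 0 ≤ w) (f : ℝ → ℝ) :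
    ∫ y, f y ∂(ENNReal.ofReal u • Measure.dirac r + ENNReal.ofReal v • Measure.dirac s
      + ENNReal.ofReal w • Measure.dirac t) = u * f r + v * f s + w * f t := by
  have hi : ∀ (u r : ℝ), Integrable f (ENNReal.ofReal u • Measure.dirac r) := fun u r =>
    (integrable_dirac (by simp)).smul_measure ENNReal.ofReal_ne_top
  rw [integral_add_measure ((hi _ _).add_measure (hi _ _)) (hi _ _),
    integral_add_measure (hi _ _) (hi _ _)]
  simp [integral_smul_measure, hu, hv, hw]

theorem stmt11
    (p : ℝ) (hp0 : 0 < p) (hp1 : p < 1)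
    (ylo μ yhi σ : ℝ) (h1 : ylo < μ) (h2 : μ < yhi) (hσ : 0 < σ)
    (hfeas : σ / (2 * (μ - ylo)) + σ / (2 * (yhi - μ)) ≤ 1)
    (wlo wmu whi : ℝ)
    (hwlo : wlo = σ / (2 * (μ - ylo)))
    (hwhi : whi = σ / (2 * (yhi - μ)))
    (hwmu : wmu = 1 - wlo - whi)
    (τ : ℝ) (hτ : 0 ≤ τ)
    (x : ℝ) (hx1 : (1 - p) * ylo ≤ x) (hx2 : x ≤ (1 - p) * yhi) :
    sSup ((fun Q : Measure ℝ =>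
        ∫ y, max (x - (1 + τ) * ((1 - p) * y)) (-(τ * x)) ∂Q) '' madSet ylo yhi μ σ) =
      wlo * (x - (1 + τ) * ((1 - p) * ylo)) +
        wmu * max (x - (1 + τ) * ((1 - p) * μ)) (-(τ * x)) - whi * (τ * x) := by
  have e1 : 0 < yhi - μ := by linarith
  have e2 : 0 < μ - ylo := by linarith
  have q : 0 < 1 - p := by linarith
  have wl0 : 0 ≤ wlo := by rw [hwlo]; positivity
  have wh0 : 0 ≤ whi := by rw [hwhi]; positivity
  have wm0 : 0 ≤ wmu := by rw [hwmu, hwlo, hwhi]; linarith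
  have kl : wlo * (μ - ylo) = σ / 2 := by rw [hwlo]; field_simp
  have kh : whi * (yhi - μ) = σ / 2 := by rw [hwhi]; field_simp
  have hlo : -(τ * x) ≤ x - (1 + τ) * ((1 - p) * ylo) := by nlinarith
  have hhi : x - (1 + τ) * ((1 - p) * yhi) ≤ -(τ * x) := by nlinarith
  apply IsGreatest.csSup_eq
  constructor
  · refine ⟨ENNReal.ofReal wlo • Measure.dirac ylo + ENNReal.ofReal wmu • Measure.dirac μ
      + ENNReal.ofReal whi • Measure.dirac yhi, ⟨⟨?_⟩, ?_, ?_, ?_⟩, ?_⟩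
    · simp only [Measure.coe_add, Measure.coe_smul, Pi.add_apply, Pi.smul_apply, measure_univ,
        smul_eq_mul, mul_one]
      rw [← ENNReal.ofReal_add wl0 wm0, ← ENNReal.ofReal_add (by positivity) wh0, hwmu]
      simp only [ENNReal.ofReal_eq_one]
      ring
    · have m1 : ylo ∈ Set.Icc ylo yhi := ⟨le_refl _, by linarith⟩
      have m2 : μ ∈ Set.Icc ylo yhi := ⟨by linarith, by linarith⟩
      have m3 : yhi ∈ Set.Icc ylo yhi := ⟨by linarith, le_refl _⟩
      simp only [Measure.coe_add, Measure.coe_smul, Pi.add_apply, Pi.smul_apply,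
        Measure.dirac_apply_of_mem m1, Measure.dirac_apply_of_mem m2,
        Measure.dirac_apply_of_mem m3, smul_eq_mul, mul_one]
      rw [← ENNReal.ofReal_add wl0 wm0, ← ENNReal.ofReal_add (by positivity) wh0, hwmu]
      simp only [ENNReal.ofReal_eq_one]
      ring
    · rw [aux_integral _ _ _ _ _ _ wl0 wm0 wh0 (fun y => y), hwmu]
      linear_combination kh - kl
    · rw [aux_integral _ _ _ _ _ _ wl0 wm0 wh0 (fun y => |y - μ|)]
      simp only [sub_self, abs_zero]
      rw [abs_of_neg (by linarith), abs_of_pos e1]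
      linear_combination kh + kl
    · simp only []
      rw [aux_integral _ _ _ _ _ _ wl0 wm0 wh0
        (fun y => max (x - (1 + τ) * ((1 - p) * y)) (-(τ * x)))]
      rw [max_eq_left hlo, max_eq_right hhi]
      ring
  · rintro _ ⟨Q, ⟨hQ, hs, hm, hd⟩, rfl⟩
    simp only []
    have hae : ∀ᵐ y ∂Q, y ∈ Set.Icc ylo yhi := by
      rw [← prob_compl_eq_zero_iff measurableSet_Icc] at hs
      exact hs
    have iy : Integrable (fun y : ℝ => y) Q :=
      Integrable.of_mem_Icc ylo yhi measurable_id.aemeasurable hae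
    have iym : Integrable (fun y : ℝ => y - μ) Q := iy.sub (integrable_const _)
    have ia : Integrable (fun y : ℝ => |y - μ|) Q := iym.abs
    have im : ∫ y, (y - μ) ∂Q = 0 := by
      rw [integral_sub iy (integrable_const _), hm]; simp
    have hif : Integrable (fun y => max (x - (1 + τ) * ((1 - p) * y)) (-(τ * x))) Q :=
      ((integrable_const _).sub ((iy.const_mul _).const_mul _)).sup (integrable_const _)
    set F := max (x - (1 + τ) * ((1 - p) * μ)) (-(τ * x)) with hF
    set L := x - (1 + τ) * ((1 - p) * ylo) with hL
    have ip := (ia.add iym).const_mul ((-(τ * x) - F) / (2 * (yhi - μ)))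
    have iq := (ia.sub iym).const_mul ((L - F) / (2 * (μ - ylo)))
    have hle := integral_mono_ae hif (((integrable_const F).add ip).add iq) (by
      filter_upwards [hae] with y hy
      have := aux_pointwise x ((1 + τ) * (1 - p)) (-(τ * x)) ylo μ yhi F L h1 h2
        (by rw [hF, mul_assoc]; exact le_max_left _ _) (le_max_right _ _)
        (by rw [hL, mul_assoc]) hlo (by rw [mul_assoc]; exact hhi) y hy.1 hy.2
      rw [mul_assoc] at this
      exact this)
    refine hle.trans (le_of_eq ?_)
    rw [integral_add' ((integrable_const F).add ip) iq, integral_add' (integrable_const F) ip,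
      integral_const_mul, integral_const_mul, integral_add' ia iym, integral_sub' ia iym, im, hd,
      hwmu, hwlo, hwhi]
    simp
    field_simp
    ring
end

section
/- Suppose w_ȳ·δ ≥ (w_y̲ + w_μ)·c. Then the maximizer of F over the six-point set S is as follows: (a) if c_m + c ≤ p·w_ȳ, then F(d_ȳ, d_ȳ) ≥ F(x, q) for all (x, q) ∈ S; (b) if p·w_ȳ < c_m + c ≤ (w_μ + w_ȳ)·p, then F(d_μ, d_μ) ≥ F(x, q) for all (x, q) ∈ S; (c) if (w_μ + w_ȳ)·p < c_m + c, then F(d_y̲, d_y̲) ≥ F(x, q) for all (x, q) ∈ S. -/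
theorem profit_low (p c cm δ x q y : ℝ) (h : dem p y ≤ q) (hx : q ≤ x) :
    profit p c cm δ x q y = p * dem p y - cm * x - c * q := by
  have e : qdel p x q y = 0 := by
    unfold qdel
    rw [max_eq_right (by linarith), min_eq_left (by linarith)]
  unfold profit
  rw [e, min_eq_left (by linarith)]
  ring

theorem profit_mid (p c cm δ x q y : ℝ) (h : q ≤ dem p y) (hx : dem p y ≤ x) :
    profit p c cm δ x q y = p * dem p y - cm * x - c * q - (c + δ) * (dem p y - q) := by
  have e : qdel p x q y = dem p y - q := by
    unfold qdel
    rw [max_eq_left (by linarith), min_eq_left (by linarith)]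
  unfold profit
  rw [e, min_eq_left (by linarith)]

theorem profit_high (p c cm δ x q y : ℝ) (h : q ≤ x) (hx : x ≤ dem p y) :
    profit p c cm δ x q y = p * x - cm * x - c * q - (c + δ) * (x - q) := by
  have e : qdel p x q y = x - q := by
    unfold qdel
    rw [max_eq_left (by linarith), min_eq_right (by linarith)]
  unfold profit
  rw [e, min_eq_right (by linarith)]
  ring

theorem stmt12
    (p c cm δ : ℝ) (hp0 : 0 < p) (hp1 : p < 1)
    (hc : 0 < c) (hcm : 0 < cm) (hδ : 0 ≤ δ) (hprof : c + δ + cm < p)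
    (ylo μ yhi σ : ℝ) (h1 : ylo < μ) (h2 : μ < yhi) (hσ : 0 < σ)
    (hfeas : σ / (2 * (μ - ylo)) + σ / (2 * (yhi - μ)) ≤ 1)
    (wlo wmu whi : ℝ)
    (hwlo : wlo = σ / (2 * (μ - ylo)))
    (hwhi : whi = σ / (2 * (yhi - μ)))
    (hwmu : wmu = 1 - wlo - whi)
    (dlo dmu dhi : ℝ)
    (hdlo : dlo = (1 - p) * ylo) (hdmu : dmu = (1 - p) * μ) (hdhi : dhi = (1 - p) * yhi)
    (F : ℝ → ℝ → ℝ)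
    (hF : F = fun x q => wlo * profit p c cm δ x q ylo + wmu * profit p c cm δ x q μ +
      whi * profit p c cm δ x q yhi)
    (S : Set (ℝ × ℝ))
    (hS : S = {(dlo, dlo), (dmu, dlo), (dmu, dmu), (dhi, dlo), (dhi, dmu), (dhi, dhi)})
    (hcase : whi * δ ≥ (wlo + wmu) * c) :
    (cm + c ≤ p * whi → ∀ pq ∈ S, F dhi dhi ≥ F pq.1 pq.2) ∧
    (p * whi < cm + c → cm + c ≤ (wmu + whi) * p → ∀ pq ∈ S, F dmu dmu ≥ F pq.1 pq.2) ∧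
    ((wmu + whi) * p < cm + c → ∀ pq ∈ S, F dlo dlo ≥ F pq.1 pq.2) := by
  have hlo : 0 < wlo := by rw [hwlo]; exact div_pos hσ (by linarith)
  have hhi : 0 < whi := by rw [hwhi]; exact div_pos hσ (by linarith)
  have hmu : 0 ≤ wmu := by rw [hwmu, hwlo, hwhi]; linarith
  have hA : dlo < dmu := by rw [hdlo, hdmu]; exact mul_lt_mul_of_pos_left h1 (by linarith)
  have hB : dmu < dhi := by rw [hdmu, hdhi]; exact mul_lt_mul_of_pos_left h2 (by linarith)
  have elo : dem p ylo = dlo := hdlo.symm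
  have emu : dem p μ = dmu := hdmu.symm
  have ehi : dem p yhi = dhi := hdhi.symm
  have hsum : wlo = 1 - wmu - whi := by linarith
  clear hwlo hwhi hwmu hfeas hdlo hdmu hdhi
  obtain ⟨IA, hIA⟩ : ∃ t, t = (wmu + whi) * p - cm - c := ⟨_, rfl⟩
  obtain ⟨QA, hQA⟩ : ∃ t, t = (wmu + whi) * (p - c - δ) - cm := ⟨_, rfl⟩
  obtain ⟨IB, hIB⟩ : ∃ t, t = whi * p - cm - c := ⟨_, rfl⟩
  obtain ⟨QB, hQB⟩ : ∃ t, t = whi * (p - c - δ) - cm := ⟨_, rfl⟩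
  have Flolo : F dlo dlo = (p - cm - c) * dlo := by
    simp only [hF]
    rw [profit_low p c cm δ dlo dlo ylo (by linarith) (by linarith),
      profit_high p c cm δ dlo dlo μ (by linarith) (by linarith),
      profit_high p c cm δ dlo dlo yhi (by linarith) (by linarith)]
    simp only [elo, emu, ehi, hIA, hQA, hIB, hQB, hsum]
    ring
  have Fmulo : F dmu dlo = (p - cm - c) * dlo + QA * (dmu - dlo) := by
    simp only [hF]
    rw [profit_low p c cm δ dmu dlo ylo (by linarith) (by linarith),
      profit_mid p c cm δ dmu dlo μ (by linarith) (by linarith),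
      profit_high p c cm δ dmu dlo yhi (by linarith) (by linarith)]
    simp only [elo, emu, ehi, hIA, hQA, hIB, hQB, hsum]
    ring
  have Fmumu : F dmu dmu = (p - cm - c) * dlo + IA * (dmu - dlo) := by
    simp only [hF]
    rw [profit_low p c cm δ dmu dmu ylo (by linarith) (by linarith),
      profit_low p c cm δ dmu dmu μ (by linarith) (by linarith),
      profit_high p c cm δ dmu dmu yhi (by linarith) (by linarith)]
    simp only [elo, emu, ehi, hIA, hQA, hIB, hQB, hsum]
    ring
  have Fhilo : F dhi dlo = (p - cm - c) * dlo + QA * (dmu - dlo) + QB * (dhi - dmu) := by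
    simp only [hF]
    rw [profit_low p c cm δ dhi dlo ylo (by linarith) (by linarith),
      profit_mid p c cm δ dhi dlo μ (by linarith) (by linarith),
      profit_mid p c cm δ dhi dlo yhi (by linarith) (by linarith)]
    simp only [elo, emu, ehi, hIA, hQA, hIB, hQB, hsum]
    ring
  have Fhimu : F dhi dmu = (p - cm - c) * dlo + IA * (dmu - dlo) + QB * (dhi - dmu) := by
    simp only [hF]
    rw [profit_low p c cm δ dhi dmu ylo (by linarith) (by linarith),
      profit_low p c cm δ dhi dmu μ (by linarith) (by linarith),
      profit_mid p c cm δ dhi dmu yhi (by linarith) (by linarith)]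
    simp only [elo, emu, ehi, hIA, hQA, hIB, hQB, hsum]
    ring
  have Fhihi : F dhi dhi = (p - cm - c) * dlo + IA * (dmu - dlo) + IB * (dhi - dmu) := by
    simp only [hF]
    rw [profit_low p c cm δ dhi dhi ylo (by linarith) (by linarith),
      profit_low p c cm δ dhi dhi μ (by linarith) (by linarith),
      profit_low p c cm δ dhi dhi yhi (by linarith) (by linarith)]
    simp only [elo, emu, ehi, hIA, hQA, hIB, hQB, hsum]
    ring
  have kA : QA ≤ IA := by rw [hQA, hIA]; subst hsum; nlinarith [mul_nonneg hmu hδ, mul_nonneg hmu hc.le, mul_pos hhi hc]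
  have kB : QB ≤ IB := by rw [hQB, hIB]; subst hsum; nlinarith
  have kC : IB ≤ IA := by rw [hIB, hIA]; nlinarith [mul_nonneg hmu hp0.le]
  have mA := mul_le_mul_of_nonneg_right kA (sub_pos.2 hA).le
  have mB := mul_le_mul_of_nonneg_right kB (sub_pos.2 hB).le
  subst hS
  simp only [Set.mem_insert_iff, Set.mem_singleton_iff]
  refine ⟨fun g => ?_, fun g g' => ?_, fun g => ?_⟩
  · have nB : 0 ≤ IB * (dhi - dmu) := mul_nonneg (by linarith) (by linarith)
    have nA : 0 ≤ IA * (dmu - dlo) := mul_nonneg (by linarith) (by linarith)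
    rintro pq (rfl | rfl | rfl | rfl | rfl | rfl) <;> simp only [Flolo, Fmulo, Fmumu, Fhilo, Fhimu, Fhihi] <;> linarith
  · have nB : IB * (dhi - dmu) ≤ 0 := mul_nonpos_of_nonpos_of_nonneg (by linarith) (by linarith)
    have nA : 0 ≤ IA * (dmu - dlo) := mul_nonneg (by linarith) (by linarith)
    rintro pq (rfl | rfl | rfl | rfl | rfl | rfl) <;> simp only [Flolo, Fmulo, Fmumu, Fhilo, Fhimu, Fhihi] <;> linarith
  · have nB : IB * (dhi - dmu) ≤ 0 := mul_nonpos_of_nonpos_of_nonneg (by linarith) (by linarith)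
    have nA : IA * (dmu - dlo) ≤ 0 := mul_nonpos_of_nonpos_of_nonneg (by linarith) (by linarith)
    rintro pq (rfl | rfl | rfl | rfl | rfl | rfl) <;> simp only [Flolo, Fmulo, Fmumu, Fhilo, Fhimu, Fhihi] <;> linarith
end

section
/- Let λ, b, c be real numbers with λ ≥ 0. Then the quadratic inequality λ·z² + b·z + c ≥ 0 holds for all z ∈ ℝ if and only if c ≥ 0 and the second-order cone condition √(b² + (c − λ)²) ≤ c + λ holds. -/
theorem stmt15 (lam b c : ℝ) (hlam : 0 ≤ lam) :
    (∀ z : ℝ, lam * z ^ 2 + b * z + c ≥ 0) ↔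
      (0 ≤ c ∧ Real.sqrt (b ^ 2 + (c - lam) ^ 2) ≤ c + lam) := by
  constructor
  · intro h
    have hc : 0 ≤ c := by simpa using h 0
    have hd : discrim lam b c ≤ 0 := discrim_le_zero (fun x => by
      have := h x
      rw [pow_two] at this
      exact this)
    unfold discrim at hd
    refine ⟨hc, Real.sqrt_le_iff.mpr ⟨by linarith, by nlinarith⟩⟩
  · rintro ⟨hc, hs⟩ z
    have h2 := (Real.sqrt_le_iff.mp hs).2
    have hd : b ^ 2 ≤ 4 * lam * c := by nlinarith
    rcases hlam.eq_or_lt with h0 | hpos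
    · subst h0
      have hb : b = 0 := by
        have : b ^ 2 = 0 := le_antisymm (by simpa using hd) (sq_nonneg b)
        exact pow_eq_zero_iff (two_ne_zero) |>.mp this
      subst hb
      simpa using hc
    · have h4 : 0 ≤ (4 * lam) * (lam * z ^ 2 + b * z + c) := by
        nlinarith [sq_nonneg (2 * lam * z + b)]
      exact nonneg_of_mul_nonneg_right h4 (by linarith)
end

section
/- Let a ≤ b and let λ ≥ 0, α, β, y be real numbers. Then strong Lagrangian duality holds for the minimization of the convex quadratic α·z + β + λ·(z − y)² over the interval [a, b]: inf_{z ∈ [a, b]} ( α·z + β + λ·(z − y)² ) = sup_{θ ≥ 0, η ≥ 0} inf_{z ∈ ℝ} ( α·z + β + λ·(z − y)² − θ·(z − a) − η·(b − z) ), where both sides are interpreted in the extended real numbers. -/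
/-- Strong Lagrangian duality for the minimization of the convex quadratic
`α·z + β + λ·(z − y)²` over the interval `[a, b]`, stated in the extended reals. -/
theorem stmt16 (a b α β y lam : ℝ) (hab : a ≤ b) (hlam : 0 ≤ lam) :
    sInf ((fun z : ℝ => ((α * z + β + lam * (z - y) ^ 2 : ℝ) : EReal)) '' Set.Icc a b) =
      sSup ((fun θη : ℝ × ℝ =>
          sInf (Set.range (fun z : ℝ =>
            ((α * z + β + lam * (z - y) ^ 2 - θη.1 * (z - a) - θη.2 * (b - z) : ℝ) : EReal)))) ''
        {θη : ℝ × ℝ | 0 ≤ θη.1 ∧ 0 ≤ θη.2}) := by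
  have key : ∃ w ∈ Set.Icc a b, ∃ θ η : ℝ, 0 ≤ θ ∧ 0 ≤ η ∧ ∀ z : ℝ,
      α * w + β + lam * (w - y) ^ 2 ≤
        α * z + β + lam * (z - y) ^ 2 - θ * (z - a) - η * (b - z) := by
    by_cases h1 : 0 ≤ α + 2 * lam * (a - y)
    · refine ⟨a, ⟨le_refl a, hab⟩, _, 0, h1, le_refl 0, fun z => ?_⟩
      have := mul_nonneg hlam (sq_nonneg (z - a))
      linarith
    by_cases h2 : α + 2 * lam * (b - y) ≤ 0
    · refine ⟨b, ⟨hab, le_refl b⟩, 0, -(α + 2 * lam * (b - y)), le_refl 0, by linarith,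
        fun z => ?_⟩
      have := mul_nonneg hlam (sq_nonneg (z - b))
      linarith
    push Not at h1 h2
    have hpos : 0 < lam := by
      rcases hlam.lt_or_eq with h | h
      · exact h
      · subst h
        linarith
    obtain ⟨w, hw⟩ : ∃ w : ℝ, α + 2 * lam * (w - y) = 0 :=
      ⟨y - α / (2 * lam), by field_simp; ring⟩
    refine ⟨w, ⟨?_, ?_⟩, 0, 0, le_refl 0, le_refl 0, fun z => ?_⟩
    · by_contra h
      push Not at h
      have := mul_pos hpos (sub_pos.2 h)
      linarith
    · by_contra h
      push Not at h
      have := mul_pos hpos (sub_pos.2 h)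
      linarith
    · have := mul_nonneg hlam (sq_nonneg (z - w))
      have h3 : α = -(2 * lam * (w - y)) := by linarith
      subst h3
      linarith
  apply le_antisymm
  · obtain ⟨w, hw, θ, η, hθ, hη, h⟩ := key
    refine (sInf_le (Set.mem_image_of_mem _ hw)).trans (le_trans ?_
      (le_sSup (Set.mem_image_of_mem _ (show (θ, η) ∈ {p : ℝ × ℝ | 0 ≤ p.1 ∧ 0 ≤ p.2} from
        ⟨hθ, hη⟩))))
    refine le_sInf ?_
    rintro _ ⟨z, rfl⟩
    exact EReal.coe_le_coe_iff.2 (h z)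
  · refine sSup_le ?_
    rintro _ ⟨⟨θ, η⟩, ⟨hθ, hη⟩, rfl⟩
    refine le_sInf ?_
    rintro _ ⟨z, hz, rfl⟩
    refine (sInf_le (Set.mem_range_self z)).trans (EReal.coe_le_coe_iff.2 ?_)
    have h1 := mul_nonneg hθ (sub_nonneg.2 hz.1)
    have h2 := mul_nonneg hη (sub_nonneg.2 hz.2)
    simp only at h1 h2 ⊢
    linarith
end
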